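/- arXiv:2403.16711 — 2 statements merged into one kernel-verified Lean document; each statement's English description precedes it below -/
import Mathlib

section
/- Let I = (S,A,α,c,c_h,P̲,P̄,h) be an IMDP, let π be a policy and ξ an adversary, with induced transition distributions p_k^s := ∑_{a∈A} π_k^a(s)·ξ_k^a(s). Define W_h^{π,ξ}(s) := 0 for all s ∈ S, and backwards for k = h-1, …, 0 define W_k^{π,ξ}(s) := Φ(p_k^s, W_{k+1}^{π,ξ}). Then the entropy of the path distribution satisfies H(I^{π,ξ}) = H(X_0) + ∑_{s∈S} α(s)·W_0^{π,ξ}(s), where H(X_0) := −∑_{s∈S} α(s)·log₂ α(s). -/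
open Finset

/-- `Φ(p,V) = -∑_q p_q log₂ p_q + ∑_q p_q V_q` (with `0·log₂ 0 = 0`,
which holds automatically since `Real.logb 2 0 = 0`). -/
noncomputable def Phi {S : Type} [Fintype S] (p V : S → ℝ) : ℝ :=
  (-∑ q, p q * Real.logb 2 (p q)) + ∑ q, p q * V q

/-- The path probability mass function on `S^{h+1}` induced by policy `π` and
adversary `ξ`: `p(s₀,…,s_h) = α(s₀) · ∏_{k=0}^{h-1} p_k^{s_k}(s_{k+1})` where
`p_k^s = ∑_a π_k^a(s)·ξ_k^a(s)`. -/
noncomputable def pathProb {S A : Type} [Fintype S] [Fintype A] (h : ℕ) (α : S → ℝ)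
    (π : ℕ → S → A → ℝ) (ξ : ℕ → S → A → S → ℝ) (path : Fin (h + 1) → S) : ℝ :=
  α (path 0) *
    ∏ k : Fin h, ∑ a, π k.1 (path k.castSucc) a * ξ k.1 (path k.castSucc) a (path k.succ)

/-- Sums over `Fin (n + 1) → S` split into the first coordinate and the tail. -/
lemma sum_fin_succ_pi {S : Type} [Fintype S] (n : ℕ) (f : (Fin (n + 1) → S) → ℝ) :
    ∑ x, f x = ∑ s, ∑ t : Fin n → S, f (Fin.cons s t) := by
  rw [← (Fin.consEquiv fun _ : Fin (n + 1) => S).sum_comp, Fintype.sum_prod_type]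
  rfl

/-- The chain rule for the entropy of a joint distribution `a s * b s t`. -/
lemma entropy_chain_rule {S T : Type} [Fintype S] [Fintype T] (a : S → ℝ) (b : S → T → ℝ)
    (hb : ∀ s, ∑ t, b s t = 1) :
    -∑ s, ∑ t, a s * b s t * Real.logb 2 (a s * b s t)
      = (-∑ s, a s * Real.logb 2 (a s)) + ∑ s, a s * -∑ t, b s t * Real.logb 2 (b s t) := by
  have key : ∀ s, ∑ t, a s * b s t * Real.logb 2 (a s * b s t)
      = a s * Real.logb 2 (a s) + a s * ∑ t, b s t * Real.logb 2 (b s t) := by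
    intro s
    have h1 : ∀ t, a s * b s t * Real.logb 2 (a s * b s t)
        = a s * Real.logb 2 (a s) * b s t + a s * (b s t * Real.logb 2 (b s t)) := by
      intro t
      by_cases ha : a s = 0
      · simp [ha]
      by_cases hb' : b s t = 0
      · simp [hb']
      rw [Real.logb_mul ha hb']
      ring
    simp_rw [h1]
    rw [sum_add_distrib, ← mul_sum, ← mul_sum, hb, mul_one]
  simp_rw [key, mul_neg]
  rw [sum_add_distrib, sum_neg_distrib]
  ring

/-- The probability that a chain with transition matrices `P k`, started at `s`,
follows the path `t`. -/
noncomputable def pathWeight {S : Type} (n : ℕ) (P : ℕ → S → S → ℝ) (s : S) (t : Fin n → S) : ℝ :=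
  ∏ k : Fin n, P k.1 ((Fin.cons s t : Fin (n + 1) → S) k.castSucc) (t k)

lemma pathWeight_cons {S : Type} (n : ℕ) (P : ℕ → S → S → ℝ) (s q : S) (t : Fin n → S) :
    pathWeight (n + 1) P s (Fin.cons q t)
      = P 0 s q * pathWeight n (fun k => P (k + 1)) q t := by
  simp only [pathWeight, Fin.prod_univ_succ, ← Fin.succ_castSucc, Fin.cons_succ, Fin.cons_zero,
    Fin.castSucc_zero, Fin.val_zero, Fin.val_succ]

lemma sum_pathWeight {S : Type} [Fintype S] (n : ℕ) (P : ℕ → S → S → ℝ)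
    (hP : ∀ k < n, ∀ s, ∑ q, P k s q = 1) (s : S) :
    ∑ t, pathWeight n P s t = 1 := by
  induction n generalizing P s with
  | zero => simp [pathWeight]
  | succ n ih =>
    have ih' := ih (fun k => P (k + 1)) fun k hk => hP (k + 1) (by omega)
    simp_rw [sum_fin_succ_pi, pathWeight_cons, ← mul_sum, ih', mul_one]
    exact hP 0 (by omega) s

/-- The entropy of the path of a chain started at `s` satisfies the backward recursion. -/
lemma entropy_pathWeight {S : Type} [Fintype S] (n : ℕ) (P : ℕ → S → S → ℝ)
    (hP : ∀ k < n, ∀ s, ∑ q, P k s q = 1) (W : ℕ → S → ℝ) (hWn : ∀ s, W n s = 0)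
    (hW : ∀ k < n, ∀ s, W k s = Phi (P k s) (W (k + 1))) (s : S) :
    -∑ t, pathWeight n P s t * Real.logb 2 (pathWeight n P s t) = W 0 s := by
  induction n generalizing P W s with
  | zero => simp [pathWeight, hWn]
  | succ n ih =>
    have hP' : ∀ k < n, ∀ s, ∑ q, P (k + 1) s q = 1 := fun k hk => hP (k + 1) (by omega)
    have ih' := ih (fun k => P (k + 1)) hP' (fun k => W (k + 1)) hWn
      fun k hk => hW (k + 1) (by omega)
    simp_rw [sum_fin_succ_pi, pathWeight_cons]
    rw [entropy_chain_rule _ _ (sum_pathWeight n _ hP'), hW 0 (by omega), Phi]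
    simp_rw [ih']

lemma pathProb_cons {S A : Type} [Fintype S] [Fintype A] (h : ℕ) (α : S → ℝ)
    (π : ℕ → S → A → ℝ) (ξ : ℕ → S → A → S → ℝ) (s : S) (t : Fin h → S) :
    pathProb h α π ξ (Fin.cons s t)
      = α s * pathWeight h (fun k s q => ∑ a, π k s a * ξ k s a q) s t := by
  simp only [pathProb, pathWeight, Fin.cons_zero, Fin.cons_succ]

/-- Recursive entropy computation: for an IMDP
`I = (S,A,α,c,c_h,P̲,P̄,h)`, a policy `π` and an adversary `ξ`, with induced
transition distributions `p_k^s = ∑_a π_k^a(s)·ξ_k^a(s)`, the backward recursion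
`W_h = 0`, `W_k(s) = Φ(p_k^s, W_{k+1})` satisfies
`H(I^{π,ξ}) = H(X₀) + ∑_s α(s) W_0(s)`, where `H(I^{π,ξ})` is the entropy of the
path distribution and `H(X₀) = -∑_s α(s) log₂ α(s)`. -/
theorem recursive_entropy_computation
    {S A : Type} [Fintype S] [Fintype A] [Nonempty S] [Nonempty A]
    (h : ℕ) (α : S → ℝ) (c : S → A → ℝ) (ch : S → ℝ)
    (Plo Pup : S → A → S → ℝ)
    (hα : (∀ s, 0 ≤ α s ∧ α s ≤ 1) ∧ ∑ s, α s = 1)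
    (hbounds : ∀ s a q, 0 ≤ Plo s a q ∧ Plo s a q ≤ Pup s a q ∧ Pup s a q ≤ 1)
    (hsums : ∀ s a, ∑ q, Plo s a q ≤ 1 ∧ 1 ≤ ∑ q, Pup s a q)
    (π : ℕ → S → A → ℝ)
    (hπ : ∀ k, k < h → ∀ s, (∀ a, 0 ≤ π k s a ∧ π k s a ≤ 1) ∧ ∑ a, π k s a = 1)
    (ξ : ℕ → S → A → S → ℝ)
    (hξ : ∀ k, k < h → ∀ s a,
      ((∀ q, 0 ≤ ξ k s a q ∧ ξ k s a q ≤ 1) ∧ ∑ q, ξ k s a q = 1) ∧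
        ∀ q, Plo s a q ≤ ξ k s a q ∧ ξ k s a q ≤ Pup s a q)
    -- induced transition distributions p_k^s = ∑_a π_k^a(s) ξ_k^a(s)
    (p : ℕ → S → S → ℝ)
    (hp : ∀ k s q, p k s q = ∑ a, π k s a * ξ k s a q)
    -- the backward recursion for W
    (W : ℕ → S → ℝ)
    (hWh : ∀ s, W h s = 0)
    (hW : ∀ k, k < h → ∀ s, W k s = Phi (p k s) (W (k + 1))) :
    -- H(I^{π,ξ}) = H(X₀) + ∑_s α(s) W_0(s)
    -∑ path : Fin (h + 1) → S,
        pathProb h α π ξ path * Real.logb 2 (pathProb h α π ξ path)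
      = (-∑ s, α s * Real.logb 2 (α s)) + ∑ s, α s * W 0 s := by
  obtain rfl : p = fun k s q => ∑ a, π k s a * ξ k s a q := by
    funext k s q
    exact hp k s q
  have hP : ∀ k < h, ∀ s, ∑ q, ∑ a, π k s a * ξ k s a q = 1 := by
    intro k hk s
    rw [sum_comm]
    simp_rw [← mul_sum, (hξ k hk s _).1.2, mul_one]
    exact (hπ k hk s).2
  simp_rw [sum_fin_succ_pi, pathProb_cons]
  rw [entropy_chain_rule _ _ (sum_pathWeight h _ hP)]
  simp_rw [entropy_pathWeight h _ hP W hWh hW]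
end

section
/- Let I = (S,A,α,c,c_h,P̲,P̄,h) be an IMDP. Define V̄*_h(s) := c_h(s) for all s ∈ S, and backwards for k = h-1, …, 0 define V̄*_k(s) := min over π_k in the probability simplex P^{|A|} of the max over choices p^a ∈ P_s^a (one for each a ∈ A) of ∑_{a∈A} π_k^a·c(s,a) + Φ(∑_{a∈A} π_k^a·p^a, V̄*_{k+1}). Then the robust optimal value satisfies min_{π∈Π} max_{ξ∈Ξ} (J^{π,ξ} + H(I^{π,ξ})) = H(X_0) + ∑_{s∈S} α(s)·V̄*_0(s), where H(X_0) := −∑_{s∈S} α(s)·log₂ α(s); in particular both the outer minimum over all policies and the inner maximum over all adversaries are attained. -/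
open Finset

/-- The probability simplex over a finite type `T`. -/
def Simplex (T : Type) [Fintype T] : Set (T → ℝ) :=
  {p | (∀ t, 0 ≤ p t ∧ p t ≤ 1) ∧ ∑ t, p t = 1}

/-- The set `P_s^a` of feasible transition distributions for state `s` and action
`a`, given interval bounds `P̲ = Plo` and `P̄ = Pup`. -/
def Feas {S A : Type} [Fintype S] (Plo Pup : S → A → S → ℝ) (s : S) (a : A) :
    Set (S → ℝ) :=
  {p | p ∈ Simplex S ∧ ∀ q, Plo s a q ≤ p q ∧ p q ≤ Pup s a q}

/-- `π` is a (Markov) policy for horizon `h`: `π k s ∈ P^{|A|}` for every `k < h`. -/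
def IsPolicy {S A : Type} [Fintype A] (h : ℕ) (π : ℕ → S → A → ℝ) : Prop :=
  ∀ k, k < h → ∀ s, π k s ∈ Simplex A

/-- `ξ` is a (Markov) adversary for horizon `h`: `ξ k s a ∈ P_s^a` for every `k < h`. -/
def IsAdversary {S A : Type} [Fintype S] (h : ℕ) (Plo Pup : S → A → S → ℝ)
    (ξ : ℕ → S → A → S → ℝ) : Prop :=
  ∀ k, k < h → ∀ s a, ξ k s a ∈ Feas Plo Pup s a

/-- The expected cumulative cost `J^{π,ξ}`. -/
noncomputable def cumCost {S A : Type} [Fintype S] [Fintype A] (h : ℕ) (α : S → ℝ)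
    (c : S → A → ℝ) (ch : S → ℝ)
    (π : ℕ → S → A → ℝ) (ξ : ℕ → S → A → S → ℝ) : ℝ :=
  ∑ path : Fin (h + 1) → S,
    pathProb h α π ξ path *
      ((∑ k : Fin h, ∑ a, π k.1 (path k.castSucc) a * c (path k.castSucc) a) +
        ch (path (Fin.last h)))

/-- The path entropy `H(I^{π,ξ})` (with `0·log₂ 0 = 0`). -/
noncomputable def pathEnt {S A : Type} [Fintype S] [Fintype A] (h : ℕ) (α : S → ℝ)
    (π : ℕ → S → A → ℝ) (ξ : ℕ → S → A → S → ℝ) : ℝ :=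
  -∑ path : Fin (h + 1) → S,
    pathProb h α π ξ path * Real.logb 2 (pathProb h α π ξ path)

section Compactness

theorem isCompact_Simplex (T : Type) [Fintype T] : IsCompact (Simplex T) := by
  refine (isCompact_Icc (a := (0 : T → ℝ)) (b := 1)).of_isClosed_subset ?_
    fun p hp => ⟨fun t => (hp.1 t).1, fun t => (hp.1 t).2⟩
  simp only [Simplex, Set.ofPred_and, Set.ofPred_forall]
  refine (isClosed_iInter fun t => ?_).inter (isClosed_eq (by fun_prop) continuous_const)
  exact (isClosed_le continuous_const (continuous_apply t)).inter
    (isClosed_le (continuous_apply t) continuous_const)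

theorem Simplex_nonempty (T : Type) [Fintype T] [Nonempty T] : (Simplex T).Nonempty := by
  classical
  refine ⟨Pi.single (Classical.arbitrary T) 1, fun t => ?_, by simp⟩
  by_cases ht : t = Classical.arbitrary T
  · subst ht; simp
  · simp [ht]

theorem isCompact_Feas {S A : Type} [Fintype S] (Plo Pup : S → A → S → ℝ) (s : S) (a : A) :
    IsCompact (Feas Plo Pup s a) := by
  refine (isCompact_Simplex S).inter_right (t := {p | ∀ q, Plo s a q ≤ p q ∧ p q ≤ Pup s a q}) ?_
  simp only [Set.ofPred_and, Set.ofPred_forall]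
  exact isClosed_iInter fun q => (isClosed_le continuous_const (continuous_apply q)).inter
    (isClosed_le (continuous_apply q) continuous_const)

theorem sum_smul_mem_Simplex {S A : Type} [Fintype S] [Fintype A] {x : A → ℝ}
    (hx : x ∈ Simplex A) {p : A → S → ℝ} (hp : ∀ a, p a ∈ Simplex S) :
    (fun q => ∑ a, x a * p a q) ∈ Simplex S := by
  refine ⟨fun q => ⟨sum_nonneg fun a _ => mul_nonneg (hx.1 a).1 ((hp a).1 q).1, ?_⟩, ?_⟩
  · calc ∑ a, x a * p a q ≤ ∑ a, x a :=
          sum_le_sum fun a _ => mul_le_of_le_one_right (hx.1 a).1 ((hp a).1 q).2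
      _ = 1 := hx.2
  · rw [sum_comm]
    simp only [← mul_sum, (hp _).2, mul_one, hx.2]

end Compactness

section StageValue

theorem Continuous.mul_logb_self {X : Type*} [TopologicalSpace X] {f : X → ℝ}
    (hf : Continuous f) (b : ℝ) : Continuous fun x => f x * Real.logb b (f x) := by
  simp only [Real.logb, ← mul_div_assoc]
  exact (Real.continuous_mul_log.comp hf).div_const _

theorem continuous_Phi {S : Type} [Fintype S] (V : S → ℝ) : Continuous fun p => Phi p V := by
  unfold Phi
  exact (continuous_finsetSum _ fun q _ => (continuous_apply q).mul_logb_self 2).neg.add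
    (by fun_prop)

theorem Phi_mono {S : Type} [Fintype S] {p V W : S → ℝ} (hp : p ∈ Simplex S)
    (hVW : ∀ q, V q ≤ W q) : Phi p V ≤ Phi p W :=
  add_le_add_right (sum_le_sum fun q _ => mul_le_mul_of_nonneg_left (hVW q) (hp.1 q).1) _

variable {S A : Type} [Fintype S] [Fintype A]

/-- The worst-case one-stage value of the mixed action `x`, where the adversary picks each
`pc a` in `F a` and `V` is the cost-to-go. -/
noncomputable def robustStage (F : A → Set (S → ℝ)) (c : A → ℝ) (V : S → ℝ) (x : A → ℝ) : ℝ :=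
  sSup {y | ∃ pc : A → S → ℝ, (∀ a, pc a ∈ F a) ∧
    y = (∑ a, x a * c a) + Phi (fun q => ∑ a, x a * pc a q) V}

theorem continuous_stage (c : A → ℝ) (V : S → ℝ) :
    Continuous fun z : (A → ℝ) × (A → S → ℝ) =>
      (∑ a, z.1 a * c a) + Phi (fun q => ∑ a, z.1 a * z.2 a q) V :=
  Continuous.add (by fun_prop) ((continuous_Phi V).comp (by fun_prop))

theorem exists_isGreatest_stage {F : A → Set (S → ℝ)} (hF : ∀ a, IsCompact (F a))
    (hne : ∀ a, (F a).Nonempty) (c : A → ℝ) (V : S → ℝ) (x : A → ℝ) :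
    ∃ pc : A → S → ℝ, (∀ a, pc a ∈ F a) ∧
      robustStage F c V x = (∑ a, x a * c a) + Phi (fun q => ∑ a, x a * pc a q) V ∧
      ∀ pc' : A → S → ℝ, (∀ a, pc' a ∈ F a) →
        (∑ a, x a * c a) + Phi (fun q => ∑ a, x a * pc' a q) V ≤ robustStage F c V x := by
  obtain ⟨pc, hpc, hmax⟩ := (isCompact_univ_pi hF).exists_isMaxOn
    (Set.univ_pi_nonempty_iff.2 hne)
    ((continuous_stage c V).comp (Continuous.prodMk_right x)).continuousOn
  have hgreatest : IsGreatest {y | ∃ pc : A → S → ℝ, (∀ a, pc a ∈ F a) ∧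
      y = (∑ a, x a * c a) + Phi (fun q => ∑ a, x a * pc a q) V} _ :=
    ⟨⟨pc, fun a => hpc a trivial, rfl⟩, by
      rintro _ ⟨pc', hpc', rfl⟩
      exact hmax fun a _ => hpc' a⟩
  have heq := hgreatest.csSup_eq
  refine ⟨pc, fun a => hpc a trivial, heq, fun pc' hpc' => ?_⟩
  exact (hgreatest.2 ⟨pc', hpc', rfl⟩).trans heq.ge

theorem continuous_robustStage {F : A → Set (S → ℝ)} (hF : ∀ a, IsCompact (F a))
    (c : A → ℝ) (V : S → ℝ) : Continuous (robustStage F c V) := by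
  have hcont := (isCompact_univ_pi hF).continuous_sSup
    (f := fun (x : A → ℝ) (pc : A → S → ℝ) => (∑ a, x a * c a) + Phi (fun q => ∑ a, x a * pc a q) V)
    (continuous_stage c V)
  convert hcont using 1
  ext x
  refine congrArg sSup (Set.ext fun y => ?_)
  simp [Set.mem_pi, eq_comm]

theorem robustStage_mono {F : A → Set (S → ℝ)} (hF : ∀ a, IsCompact (F a))
    (hne : ∀ a, (F a).Nonempty) (hsub : ∀ a, F a ⊆ Simplex S) (c : A → ℝ) {V W : S → ℝ}
    (hVW : ∀ q, V q ≤ W q) {x : A → ℝ} (hx : x ∈ Simplex A) :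
    robustStage F c V x ≤ robustStage F c W x := by
  obtain ⟨pc, hpc, heq, -⟩ := exists_isGreatest_stage hF hne c V x
  obtain ⟨-, -, -, hmax⟩ := exists_isGreatest_stage hF hne c W x
  rw [heq]
  refine le_trans (add_le_add_right (Phi_mono ?_ hVW) _) (hmax pc hpc)
  exact sum_smul_mem_Simplex hx fun a => hsub a (hpc a)

theorem exists_isLeast_robustStage [Nonempty A] {F : A → Set (S → ℝ)}
    (hF : ∀ a, IsCompact (F a)) (c : A → ℝ) (V : S → ℝ) :
    ∃ x ∈ Simplex A, IsLeast {y | ∃ x ∈ Simplex A, y = robustStage F c V x}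
      (robustStage F c V x) := by
  obtain ⟨x, hx, hmin⟩ := (isCompact_Simplex A).exists_isMinOn (Simplex_nonempty A)
    (continuous_robustStage hF c V).continuousOn
  refine ⟨x, hx, ⟨x, hx, rfl⟩, ?_⟩
  rintro _ ⟨x', hx', rfl⟩
  exact hmin hx'

end StageValue

section BackwardRecursion

theorem exists_backward_recursion {X : Type*} (h : ℕ) (T : ℕ → X → X) (g : X) :
    ∃ W : ℕ → X, W h = g ∧ ∀ k, k < h → W k = T k (W (k + 1)) := by
  refine ⟨fun k => Nat.rec g (fun j w => T (h - 1 - j) w) (h - k), by simp, fun k hk => ?_⟩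
  obtain ⟨j, rfl⟩ : ∃ j, h = k + 1 + j := ⟨h - k - 1, by omega⟩
  have h₁ : k + 1 + j - k = j + 1 := by omega
  have h₂ : k + 1 + j - (k + 1) = j := by omega
  have h₃ : k + 1 + j - 1 - j = k := by omega
  simp only [h₁, h₂, h₃]

theorem le_of_backward_step {S : Type*} {h : ℕ} {W U : ℕ → S → ℝ} (hend : ∀ s, W h s ≤ U h s)
    (hstep : ∀ k, k < h → (∀ s, W (k + 1) s ≤ U (k + 1) s) → ∀ s, W k s ≤ U k s) (s : S) :
    W 0 s ≤ U 0 s :=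
  Nat.decreasingInduction (motive := fun k _ => ∀ s, W k s ≤ U k s)
    (fun k hk ih => hstep k hk ih) hend (Nat.zero_le h) s

end BackwardRecursion

section PathDecomposition

theorem mul_mul_logb_mul (b x y : ℝ) :
    x * y * Real.logb b (x * y) = y * (x * Real.logb b x) + x * (y * Real.logb b y) := by
  rcases eq_or_ne x 0 with rfl | hx
  · simp
  rcases eq_or_ne y 0 with rfl | hy
  · simp
  rw [Real.logb_mul hx hy]
  ring

variable {S : Type}

/-- The probability of a path of an inhomogeneous Markov chain. -/
noncomputable def chainProb (h : ℕ) (α : S → ℝ) (p : ℕ → S → S → ℝ) (path : Fin (h + 1) → S) : ℝ :=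
  α (path 0) * ∏ k : Fin h, p k.1 (path k.castSucc) (path k.succ)

/-- Cumulative cost along a path. -/
noncomputable def chainCost (h : ℕ) (r : ℕ → S → ℝ) (g : S → ℝ) (path : Fin (h + 1) → S) : ℝ :=
  (∑ k : Fin h, r k.1 (path k.castSucc)) + g (path (Fin.last h))

theorem chainProb_cons (h : ℕ) (α : S → ℝ) (p : ℕ → S → S → ℝ) (s : S) (path : Fin (h + 1) → S) :
    chainProb (h + 1) α p (Fin.cons s path) =
      α s * chainProb h (p 0 s) (fun k => p (k + 1)) path := by
  simp [chainProb, Fin.prod_univ_succ]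

theorem chainCost_cons (h : ℕ) (r : ℕ → S → ℝ) (g : S → ℝ) (s : S) (path : Fin (h + 1) → S) :
    chainCost (h + 1) r g (Fin.cons s path) =
      r 0 s + chainCost h (fun k => r (k + 1)) g path := by
  simp [chainCost, Fin.sum_univ_succ, ← Fin.succ_last, add_assoc]

variable [Fintype S]

theorem sum_path_succ (h : ℕ) (f : (Fin (h + 2) → S) → ℝ) :
    ∑ path, f path = ∑ s, ∑ path : Fin (h + 1) → S, f (Fin.cons s path) := by
  rw [← (Fin.consEquiv fun _ : Fin (h + 2) => S).sum_comp, Fintype.sum_prod_type]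
  rfl

theorem sum_path_zero (f : (Fin 1 → S) → ℝ) :
    ∑ path, f path = ∑ s, f fun _ => s :=
  ((Equiv.funUnique (Fin 1) S).symm.sum_comp f).symm

theorem sum_chainProb (h : ℕ) {α : S → ℝ} {p : ℕ → S → S → ℝ} (hα : α ∈ Simplex S)
    (hp : ∀ k, k < h → ∀ s, p k s ∈ Simplex S) : ∑ path, chainProb h α p path = 1 := by
  induction h generalizing α p with
  | zero => simpa [sum_path_zero, chainProb] using hα.2
  | succ h ih =>
    simp only [sum_path_succ, chainProb_cons, ← mul_sum]
    rw [← hα.2]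
    refine sum_congr rfl fun s _ => ?_
    rw [ih (hp 0 h.succ_pos s) fun k hk => hp (k + 1) (by omega), mul_one]

/-- Expected cumulative cost plus path entropy satisfies the Bellman recursion. -/
theorem chain_cost_add_entropy (h : ℕ) {α : S → ℝ} {p : ℕ → S → S → ℝ} {r : ℕ → S → ℝ}
    {g : S → ℝ} {W : ℕ → S → ℝ} (hα : α ∈ Simplex S)
    (hp : ∀ k, k < h → ∀ s, p k s ∈ Simplex S) (hend : ∀ s, W h s = g s)
    (hW : ∀ k, k < h → ∀ s, W k s = r k s + Phi (p k s) (W (k + 1))) :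
    ∑ path, chainProb h α p path * chainCost h r g path +
        -∑ path, chainProb h α p path * Real.logb 2 (chainProb h α p path) =
      Phi α (W 0) := by
  induction h generalizing α p r W with
  | zero => simp [sum_path_zero, chainProb, chainCost, Phi, hend, add_comm]
  | succ h ih =>
    have hp' : ∀ k, k < h → ∀ s, p (k + 1) s ∈ Simplex S := fun k hk => hp (k + 1) (by omega)
    have hstep : ∀ s, ∑ path, chainProb (h + 1) α p (Fin.cons s path) *
          chainCost (h + 1) r g (Fin.cons s path) +
        -∑ path, chainProb (h + 1) α p (Fin.cons s path) *
          Real.logb 2 (chainProb (h + 1) α p (Fin.cons s path)) =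
        -(α s * Real.logb 2 (α s)) + α s * W 0 s := by
      intro s
      have hs := hp 0 h.succ_pos s
      have hih := ih (W := fun k => W (k + 1)) (r := fun k => r (k + 1)) hs hp' hend
        fun k hk => hW (k + 1) (by omega)
      have hone := sum_chainProb h hs hp'
      simp only [chainProb_cons, chainCost_cons, mul_mul_logb_mul]
      simp only [sum_add_distrib, ← sum_mul, ← mul_sum, mul_assoc, mul_add, hone]
      rw [hW 0 h.succ_pos s, ← hih]
      ring
    simp only [sum_path_succ, Phi]
    rw [← sum_neg_distrib, ← sum_neg_distrib, ← sum_add_distrib, ← sum_add_distrib]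
    exact sum_congr rfl fun s _ => hstep s

end PathDecomposition

section RobustPolicyEvaluation

variable {S A : Type} [Fintype S] [Fintype A] {h : ℕ} {α : S → ℝ} {c : S → A → ℝ} {ch : S → ℝ}
  {Plo Pup : S → A → S → ℝ} {π : ℕ → S → A → ℝ}

theorem cumCost_add_pathEnt_eq {ξ : ℕ → S → A → S → ℝ} {W : ℕ → S → ℝ} (hα : α ∈ Simplex S)
    (hπ : IsPolicy h π) (hξ : IsAdversary h Plo Pup ξ) (hend : ∀ s, W h s = ch s)
    (hW : ∀ k, k < h → ∀ s, W k s =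
      (∑ a, π k s a * c s a) + Phi (fun q => ∑ a, π k s a * ξ k s a q) (W (k + 1))) :
    cumCost h α c ch π ξ + pathEnt h α π ξ = Phi α (W 0) :=
  chain_cost_add_entropy (p := fun k s q => ∑ a, π k s a * ξ k s a q)
    (r := fun k s => ∑ a, π k s a * c s a) h hα
    (fun k hk s => sum_smul_mem_Simplex (hπ k hk s) fun a => (hξ k hk s a).1) hend hW

theorem exists_worst_adversary (hα : α ∈ Simplex S) (hfeas : ∀ s a, (Feas Plo Pup s a).Nonempty)
    (hπ : IsPolicy h π) {U : ℕ → S → ℝ} (hend : ∀ s, U h s = ch s)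
    (hU : ∀ k, k < h → ∀ s,
      U k s = robustStage (Feas Plo Pup s) (c s) (U (k + 1)) (π k s)) :
    ∃ ξs, IsAdversary h Plo Pup ξs ∧
      cumCost h α c ch π ξs + pathEnt h α π ξs = Phi α (U 0) ∧
      ∀ ξ, IsAdversary h Plo Pup ξ →
        cumCost h α c ch π ξ + pathEnt h α π ξ ≤ Phi α (U 0) := by
  choose ξs hξs heq hmax using fun (k : ℕ) (s : S) =>
    exists_isGreatest_stage (isCompact_Feas Plo Pup s) (hfeas s) (c s) (U (k + 1)) (π k s)
  have hadv : IsAdversary h Plo Pup ξs := fun k _ s => hξs k s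
  refine ⟨ξs, hadv, cumCost_add_pathEnt_eq hα hπ hadv hend
    fun k hk s => (hU k hk s).trans (heq k s), fun ξ hξ => ?_⟩
  obtain ⟨W, hWend, hW⟩ := exists_backward_recursion h (fun k (w : S → ℝ) s =>
    (∑ a, π k s a * c s a) + Phi (fun q => ∑ a, π k s a * ξ k s a q) w) ch
  rw [cumCost_add_pathEnt_eq hα hπ hξ (congrFun hWend) fun k hk => congrFun (hW k hk)]
  refine Phi_mono hα (le_of_backward_step (h := h) (fun s => (by rw [hWend, hend s])) ?_)
  intro k hk ih s
  rw [hW k hk, hU k hk s]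
  refine le_trans (add_le_add_right (Phi_mono ?_ ih) _) (hmax k s (ξ k s) (hξ k hk s))
  exact sum_smul_mem_Simplex (hπ k hk s) fun a => (hξ k hk s a).1

theorem sSup_adversary_eq (hα : α ∈ Simplex S) (hfeas : ∀ s a, (Feas Plo Pup s a).Nonempty)
    (hπ : IsPolicy h π) {U : ℕ → S → ℝ} (hend : ∀ s, U h s = ch s)
    (hU : ∀ k, k < h → ∀ s,
      U k s = robustStage (Feas Plo Pup s) (c s) (U (k + 1)) (π k s)) :
    sSup {y | ∃ ξ, IsAdversary h Plo Pup ξ ∧ y = cumCost h α c ch π ξ + pathEnt h α π ξ} =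
      Phi α (U 0) := by
  obtain ⟨ξs, hξs, heq, hmax⟩ := exists_worst_adversary hα hfeas hπ hend hU
  refine IsGreatest.csSup_eq ⟨⟨ξs, hξs, heq.symm⟩, ?_⟩
  rintro _ ⟨ξ, hξ, rfl⟩
  exact hmax ξ hξ

theorem exists_policy_value (h : ℕ) (c : S → A → ℝ) (ch : S → ℝ) (Plo Pup : S → A → S → ℝ)
    (π : ℕ → S → A → ℝ) :
    ∃ U : ℕ → S → ℝ, (∀ s, U h s = ch s) ∧ ∀ k, k < h → ∀ s,
      U k s = robustStage (Feas Plo Pup s) (c s) (U (k + 1)) (π k s) := by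
  obtain ⟨U, hend, hU⟩ := exists_backward_recursion h
    (fun k (u : S → ℝ) s => robustStage (Feas Plo Pup s) (c s) u (π k s)) ch
  exact ⟨U, congrFun hend, fun k hk => congrFun (hU k hk)⟩

end RobustPolicyEvaluation

/-- Cost–entropy trade-off minimization: for an IMDP
`I = (S,A,α,c,c_h,P̲,P̄,h)`, with `V̄*` defined by `V̄*_h = c_h` and the backward
min–max recursion
`V̄*_k(s) = min_{π_k ∈ P^{|A|}} max_{p^a ∈ P_s^a} [∑_a π_k^a c(s,a) + Φ(∑_a π_k^a p^a, V̄*_{k+1})]`,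
the robust optimal value satisfies
`min_{π∈Π} max_{ξ∈Ξ} (J^{π,ξ} + H(I^{π,ξ})) = H(X₀) + ∑_s α(s) V̄*_0(s)`;
moreover the outer minimum over policies and the inner maximum over adversaries are
attained. -/
theorem cost_entropy_tradeoff_minimization
    {S A : Type} [Fintype S] [Fintype A] [Nonempty S] [Nonempty A]
    (h : ℕ) (α : S → ℝ) (c : S → A → ℝ) (ch : S → ℝ)
    (Plo Pup : S → A → S → ℝ)
    (hα : α ∈ Simplex S)
    (hbounds : ∀ s a q, 0 ≤ Plo s a q ∧ Plo s a q ≤ Pup s a q ∧ Pup s a q ≤ 1)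
    (hsums : ∀ s a, ∑ q, Plo s a q ≤ 1 ∧ 1 ≤ ∑ q, Pup s a q)
    (hfeas : ∀ s a, (Feas Plo Pup s a).Nonempty)
    -- the value-iteration recursion
    (V : ℕ → S → ℝ)
    (hVh : ∀ s, V h s = ch s)
    (hV : ∀ k, k < h → ∀ s,
      V k s = sInf {x | ∃ πk ∈ Simplex A, x =
        sSup {y | ∃ pc : A → S → ℝ, (∀ a, pc a ∈ Feas Plo Pup s a) ∧
          y = (∑ a, πk a * c s a) +
            Phi (fun q => ∑ a, πk a * pc a q) (V (k + 1))}}) :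
    -- min over policies of max over adversaries equals H(X₀) + ∑_s α(s) V̄*_0(s)
    (sInf {x | ∃ π, IsPolicy h π ∧ x =
        sSup {y | ∃ ξ, IsAdversary h Plo Pup ξ ∧
          y = cumCost h α c ch π ξ + pathEnt h α π ξ}}
      = (-∑ s, α s * Real.logb 2 (α s)) + ∑ s, α s * V 0 s)
    ∧
    -- the outer minimum over policies is attained
    (∃ πs, IsPolicy h πs ∧
      sSup {y | ∃ ξ, IsAdversary h Plo Pup ξ ∧
          y = cumCost h α c ch πs ξ + pathEnt h α πs ξ}
        = (-∑ s, α s * Real.logb 2 (α s)) + ∑ s, α s * V 0 s)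
    ∧
    -- for every policy, the inner maximum over adversaries is attained
    (∀ π, IsPolicy h π → ∃ ξs, IsAdversary h Plo Pup ξs ∧
      ∀ ξ, IsAdversary h Plo Pup ξ →
        cumCost h α c ch π ξ + pathEnt h α π ξ ≤
          cumCost h α c ch π ξs + pathEnt h α π ξs) := by
  choose πs hπs hleast using fun (k : ℕ) (s : S) =>
    exists_isLeast_robustStage (isCompact_Feas Plo Pup s) (c s) (V (k + 1))
  have hpol : IsPolicy h πs := fun k _ s => hπs k s
  have hopt := sSup_adversary_eq (c := c) hα hfeas hpol hVh
    fun k hk s => (hV k hk s).trans (hleast k s).csInf_eq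
  refine ⟨IsLeast.csInf_eq ⟨⟨πs, hpol, hopt.symm⟩, ?_⟩, ⟨πs, hpol, hopt⟩, fun π hπ => ?_⟩
  · rintro _ ⟨π, hπ, rfl⟩
    obtain ⟨U, hend, hU⟩ := exists_policy_value h c ch Plo Pup π
    rw [sSup_adversary_eq hα hfeas hπ hend hU]
    refine Phi_mono hα (le_of_backward_step (fun s => by rw [hVh s, hend s]) ?_)
    intro k hk ih s
    calc V k s = robustStage (Feas Plo Pup s) (c s) (V (k + 1)) (πs k s) :=
          (hV k hk s).trans (hleast k s).csInf_eq
      _ ≤ robustStage (Feas Plo Pup s) (c s) (V (k + 1)) (π k s) :=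
          (hleast k s).2 ⟨π k s, hπ k hk s, rfl⟩
      _ ≤ robustStage (Feas Plo Pup s) (c s) (U (k + 1)) (π k s) :=
          robustStage_mono (isCompact_Feas Plo Pup s) (hfeas s) (fun a p hp => hp.1) (c s) ih
            (hπ k hk s)
      _ = U k s := (hU k hk s).symm
  · obtain ⟨U, hend, hU⟩ := exists_policy_value h c ch Plo Pup π
    obtain ⟨ξs, hξs, heq, hmax⟩ := exists_worst_adversary hα hfeas hπ hend hU
    exact ⟨ξs, hξs, fun ξ hξ => (hmax ξ hξ).trans heq.ge⟩
end
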